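/- Fix a system of positive coset-depending weights w. Let 𝒫^{cw} be the coset weighted pure potential subspace (games c with c_i(s) = w_i(s_{-i})·(P(s) − (1/k_i)·Σ_{x∈S_i} P(x,s_{-i})) for some P : S → ℝ), let 𝒩 be the subspace of non-strategic games, and let ℋ^{cw} be the orthogonal complement of the coset weighted potential subspace 𝒢_P^{cw}. Then the space of games decomposes as the orthogonal direct sum 𝒢 = 𝒫^{cw} ⊕ 𝒩 ⊕ ℋ^{cw}: the three subspaces are pairwise orthogonal with respect to ⟨c,c'⟩ = Σ_i Σ_s c_i(s)c'_i(s), and every game c ∈ 𝒢 is uniquely the sum of an element of 𝒫^{cw}, an element of 𝒩, and an element of ℋ^{cw}. -/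

import Mathlib

/-- `f : S → ℝ` depends only on the strategies of the players other than `i`
(i.e. it is a function of `s_{-i}`). -/
def IndepOf {n : ℕ} {k : Fin n → ℕ} (i : Fin n) (f : (∀ j, Fin (k j)) → ℝ) : Prop :=
  ∀ (s : ∀ j, Fin (k j)) (x : Fin (k i)), f (Function.update s i x) = f s

/-- `P` is a coset weighted potential function for the game `c` with respect to the
coset-depending weights `w`. -/
def IsCWPotentialFn {n : ℕ} {k : Fin n → ℕ} (c w : Fin n → (∀ j, Fin (k j)) → ℝ)
    (P : (∀ j, Fin (k j)) → ℝ) : Prop :=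
  ∀ (i : Fin n) (s : ∀ j, Fin (k j)) (x y : Fin (k i)),
    c i (Function.update s i x) - c i (Function.update s i y)
      = w i s * (P (Function.update s i x) - P (Function.update s i y))

/-- `c` is a coset weighted potential game with respect to `w`. -/
def IsCWPG {n : ℕ} {k : Fin n → ℕ} (w c : Fin n → (∀ j, Fin (k j)) → ℝ) : Prop :=
  ∃ P, IsCWPotentialFn c w P

/-- `c` is a coset weighted pure potential game w.r.t. `w`:
`c_i(s) = w_i(s_{-i}) (P(s) − (1/k_i) Σ_{x ∈ S_i} P(x, s_{-i}))` for some `P`. -/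
def IsCWPurePotential {n : ℕ} {k : Fin n → ℕ}
    (w c : Fin n → (∀ j, Fin (k j)) → ℝ) : Prop :=
  ∃ P : (∀ j, Fin (k j)) → ℝ, ∀ (i : Fin n) (s : ∀ j, Fin (k j)),
    c i s = w i s * (P s - (1 / (k i : ℝ)) * ∑ x : Fin (k i), P (Function.update s i x))

/-- `c` is a non-strategic game. -/
def IsNonStrategic {n : ℕ} {k : Fin n → ℕ} (c : Fin n → (∀ j, Fin (k j)) → ℝ) : Prop :=
  ∀ (i : Fin n) (s : ∀ j, Fin (k j)) (x y : Fin (k i)),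
    c i (Function.update s i x) = c i (Function.update s i y)

/-- The inner product `⟨c, c'⟩ = Σ_i Σ_s c_i(s) c'_i(s)` on the space of games. -/
noncomputable def gameInner {n : ℕ} {k : Fin n → ℕ}
    (c c' : Fin n → (∀ j, Fin (k j)) → ℝ) : ℝ :=
  ∑ i : Fin n, ∑ s : ∀ j, Fin (k j), c i s * c' i s

/-- `c` is a coset weighted pure harmonic game w.r.t. `w`: it is orthogonal to every
coset weighted potential game w.r.t. `w`. -/
def IsCWPureHarmonic {n : ℕ} {k : Fin n → ℕ}
    (w c : Fin n → (∀ j, Fin (k j)) → ℝ) : Prop :=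
  ∀ c' : Fin n → (∀ j, Fin (k j)) → ℝ, IsCWPG w c' → gameInner c c' = 0

section GameInner

variable {n : ℕ} {k : Fin n → ℕ}

theorem gameInner_add_left (a b c : Fin n → (∀ j, Fin (k j)) → ℝ) :
    gameInner (a + b) c = gameInner a c + gameInner b c := by
  simp [gameInner, add_mul, Finset.sum_add_distrib]

theorem gameInner_smul_left (r : ℝ) (a c : Fin n → (∀ j, Fin (k j)) → ℝ) :
    gameInner (r • a) c = r * gameInner a c := by
  simp [gameInner, mul_assoc, Finset.mul_sum]

theorem gameInner_comm (a b : Fin n → (∀ j, Fin (k j)) → ℝ) :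
    gameInner a b = gameInner b a := by
  simp only [gameInner, mul_comm]

theorem gameInner_add_right (a b c : Fin n → (∀ j, Fin (k j)) → ℝ) :
    gameInner a (b + c) = gameInner a b + gameInner a c := by
  rw [gameInner_comm, gameInner_add_left, gameInner_comm b, gameInner_comm c]

theorem gameInner_smul_right (r : ℝ) (a c : Fin n → (∀ j, Fin (k j)) → ℝ) :
    gameInner a (r • c) = r * gameInner a c := by
  rw [gameInner_comm, gameInner_smul_left, gameInner_comm]

theorem gameInner_sub_right (a b c : Fin n → (∀ j, Fin (k j)) → ℝ) :
    gameInner a (b - c) = gameInner a b - gameInner a c := by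
  simp [gameInner, mul_sub, Finset.sum_sub_distrib]

theorem eq_zero_of_gameInner_self {a : Fin n → (∀ j, Fin (k j)) → ℝ}
    (h : gameInner a a = 0) : a = 0 := by
  have hnn (i : Fin n) : 0 ≤ ∑ s, a i s * a i s :=
    Finset.sum_nonneg fun s _ => mul_self_nonneg _
  funext i s
  have hi := (Finset.sum_eq_zero_iff_of_nonneg fun i _ => hnn i).1 h i (Finset.mem_univ i)
  exact mul_self_eq_zero.1 <|
    (Finset.sum_eq_zero_iff_of_nonneg fun s _ => mul_self_nonneg (a i s)).1 hi s
      (Finset.mem_univ s)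

/-- The inner product on the space of games as a bilinear form. -/
noncomputable def gameForm (k : Fin n → ℕ) :
    LinearMap.BilinForm ℝ (Fin n → (∀ j, Fin (k j)) → ℝ) :=
  LinearMap.mk₂ ℝ gameInner gameInner_add_left gameInner_smul_left gameInner_add_right
    gameInner_smul_right

theorem gameForm_apply (a b : Fin n → (∀ j, Fin (k j)) → ℝ) :
    gameForm k a b = gameInner a b := rfl

end GameInner

section Subspaces

variable {n : ℕ} {k : Fin n → ℕ} {w : Fin n → (∀ j, Fin (k j)) → ℝ}

theorem sum_sum_update (i : Fin n) (f : (∀ j, Fin (k j)) → ℝ) :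
    ∑ s, ∑ x : Fin (k i), f (Function.update s i x) = k i * ∑ s, f s := by
  have hinv : Function.Involutive fun p : (∀ j, Fin (k j)) × Fin (k i) =>
      (Function.update p.1 i p.2, p.1 i) := fun p => by simp
  calc ∑ s, ∑ x : Fin (k i), f (Function.update s i x)
      = ∑ p : (∀ j, Fin (k j)) × Fin (k i), f (Function.update p.1 i p.2) :=
        (Fintype.sum_prod_type fun p : (∀ j, Fin (k j)) × Fin (k i) =>
          f (Function.update p.1 i p.2)).symm
    _ = ∑ p : (∀ j, Fin (k j)) × Fin (k i), f p.1 :=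
        Equiv.sum_comp hinv.toPerm fun p => f p.1
    _ = k i * ∑ s, f s := by
        rw [Fintype.sum_prod_type]
        simp [Finset.mul_sum]

theorem IsNonStrategic.indepOf {c : Fin n → (∀ j, Fin (k j)) → ℝ} (hc : IsNonStrategic c)
    (i : Fin n) : IndepOf i (c i) := fun s x => by
  simpa using hc i s x (s i)

theorem IsNonStrategic.sub {a b : Fin n → (∀ j, Fin (k j)) → ℝ} (ha : IsNonStrategic a)
    (hb : IsNonStrategic b) : IsNonStrategic (a - b) := fun i s x y => by
  simp [ha i s x y, hb i s x y]

theorem IsNonStrategic.isCWPG {c : Fin n → (∀ j, Fin (k j)) → ℝ} (hc : IsNonStrategic c) :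
    IsCWPG w c :=
  ⟨0, fun i s x y => by simp [hc i s x y]⟩

theorem IsCWPurePotential.sub {a b : Fin n → (∀ j, Fin (k j)) → ℝ}
    (ha : IsCWPurePotential w a) (hb : IsCWPurePotential w b) :
    IsCWPurePotential w (a - b) := by
  obtain ⟨P, hP⟩ := ha
  obtain ⟨Q, hQ⟩ := hb
  refine ⟨P - Q, fun i s => ?_⟩
  simp only [Pi.sub_apply, hP, hQ, Finset.sum_sub_distrib]
  ring

theorem IsCWPurePotential.isCWPG (hwI : ∀ i, IndepOf i (w i))
    {c : Fin n → (∀ j, Fin (k j)) → ℝ} (hc : IsCWPurePotential w c) : IsCWPG w c := by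
  obtain ⟨P, hP⟩ := hc
  refine ⟨P, fun i s x y => ?_⟩
  simp only [hP, hwI i s x, hwI i s y, Function.update_idem]
  ring

theorem IsCWPG.exists_isCWPurePotential_add (hwI : ∀ i, IndepOf i (w i))
    {c : Fin n → (∀ j, Fin (k j)) → ℝ} (hc : IsCWPG w c) :
    ∃ p q, IsCWPurePotential w p ∧ IsNonStrategic q ∧ p + q = c := by
  obtain ⟨P, hP⟩ := hc
  let p : Fin n → (∀ j, Fin (k j)) → ℝ := fun i s =>
    w i s * (P s - (1 / (k i : ℝ)) * ∑ x : Fin (k i), P (Function.update s i x))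
  refine ⟨p, c - p, ⟨P, fun i s => rfl⟩, fun i s x y => ?_, add_sub_cancel p c⟩
  simp only [p, Pi.sub_apply, hwI i s x, hwI i s y, Function.update_idem]
  linear_combination hP i s x y

theorem IsCWPureHarmonic.sub {a b : Fin n → (∀ j, Fin (k j)) → ℝ}
    (ha : IsCWPureHarmonic w a) (hb : IsCWPureHarmonic w b) :
    IsCWPureHarmonic w (a - b) := fun c hc => by
  rw [gameInner_comm, gameInner_sub_right, gameInner_comm c, gameInner_comm c, ha c hc,
    hb c hc, sub_zero]

theorem IsCWPurePotential.gameInner_isNonStrategic (hk : ∀ i, k i ≠ 0)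
    (hwI : ∀ i, IndepOf i (w i)) {p q : Fin n → (∀ j, Fin (k j)) → ℝ}
    (hp : IsCWPurePotential w p) (hq : IsNonStrategic q) : gameInner p q = 0 := by
  obtain ⟨P, hP⟩ := hp
  refine Finset.sum_eq_zero fun i _ => ?_
  have hki : (k i : ℝ) ≠ 0 := Nat.cast_ne_zero.2 (hk i)
  have key := sum_sum_update i fun s => w i s * q i s * P s
  simp only [hwI i _ _, hq.indepOf i _ _, ← Finset.mul_sum] at key
  calc ∑ s, p i s * q i s
      = ∑ s, w i s * q i s * P s - (1 / (k i : ℝ)) *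
          ∑ s, w i s * q i s * ∑ x : Fin (k i), P (Function.update s i x) := by
        rw [Finset.mul_sum, ← Finset.sum_sub_distrib]
        refine Finset.sum_congr rfl fun s _ => ?_
        rw [hP]
        ring
    _ = 0 := by
        rw [key]
        field_simp
        ring

/-- The subspace of coset weighted potential games with respect to `w`. -/
def cwPotentialSubmodule (w : Fin n → (∀ j, Fin (k j)) → ℝ) :
    Submodule ℝ (Fin n → (∀ j, Fin (k j)) → ℝ) where
  carrier := {c | IsCWPG w c}
  zero_mem' := ⟨0, fun i s x y => by simp⟩
  add_mem' := by
    rintro a b ⟨P, hP⟩ ⟨Q, hQ⟩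
    refine ⟨P + Q, fun i s x y => ?_⟩
    simp only [Pi.add_apply]
    linear_combination hP i s x y + hQ i s x y
  smul_mem' := by
    rintro r a ⟨P, hP⟩
    refine ⟨r • P, fun i s x y => ?_⟩
    simp only [Pi.smul_apply, smul_eq_mul]
    linear_combination r * hP i s x y

theorem exists_isCWPG_add_isCWPureHarmonic (w c : Fin n → (∀ j, Fin (k j)) → ℝ) :
    ∃ v h, IsCWPG w v ∧ IsCWPureHarmonic w h ∧ v + h = c := by
  have hrefl : (gameForm k).IsRefl := fun a b hab => by
    rwa [gameForm_apply, gameInner_comm, ← gameForm_apply]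
  have hcompl : IsCompl (cwPotentialSubmodule w)
      ((gameForm k).orthogonal (cwPotentialSubmodule w)) := by
    rw [LinearMap.BilinForm.isCompl_orthogonal_iff_disjoint hrefl, Submodule.disjoint_def]
    exact fun a ha ha' => eq_zero_of_gameInner_self (ha' a ha)
  obtain ⟨v, hv, h, hh, rfl⟩ :=
    Submodule.mem_sup.1 (hcompl.sup_eq_top ▸ Submodule.mem_top (x := c))
  exact ⟨v, h, hv, fun c' hc' => (gameInner_comm h c').trans (hh c' hc'), rfl⟩

end Subspaces

theorem eq_zero_of_add_add_eq_zero {n : ℕ} {k : Fin n → ℕ}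
    {a b c : Fin n → (∀ j, Fin (k j)) → ℝ} (hab : gameInner a b = 0)
    (hac : gameInner a c = 0) (h : a + b + c = 0) : a = 0 := by
  refine eq_zero_of_gameInner_self ?_
  have h0 : gameInner a (a + b + c) = 0 := by
    rw [h]
    simp [gameInner]
  rwa [gameInner_add_right, gameInner_add_right, hab, hac, add_zero, add_zero] at h0

/-- **Orthogonal decomposition (1.5):** `𝒢 = 𝒫^{cw} ⊕ 𝒩 ⊕ ℋ^{cw}`.
The three subspaces are pairwise orthogonal and every game is uniquely the sum of a
coset weighted pure potential game, a non-strategic game, and a coset weighted pure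
harmonic game. -/
theorem orthogonal_decomposition (n : ℕ) (hn : 2 ≤ n) (k : Fin n → ℕ)
    (hk : ∀ i, 2 ≤ k i) (w : Fin n → (∀ j, Fin (k j)) → ℝ)
    (hw : ∀ i s, 0 < w i s) (hwI : ∀ i, IndepOf i (w i)) :
    (∀ p q : Fin n → (∀ j, Fin (k j)) → ℝ,
        IsCWPurePotential w p → IsNonStrategic q → gameInner p q = 0) ∧
    (∀ p h : Fin n → (∀ j, Fin (k j)) → ℝ,
        IsCWPurePotential w p → IsCWPureHarmonic w h → gameInner p h = 0) ∧
    (∀ q h : Fin n → (∀ j, Fin (k j)) → ℝ,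
        IsNonStrategic q → IsCWPureHarmonic w h → gameInner q h = 0) ∧
    (∀ c : Fin n → (∀ j, Fin (k j)) → ℝ,
        ∃ p q h : Fin n → (∀ j, Fin (k j)) → ℝ,
          IsCWPurePotential w p ∧ IsNonStrategic q ∧ IsCWPureHarmonic w h ∧
          c = p + q + h ∧
          ∀ p' q' h' : Fin n → (∀ j, Fin (k j)) → ℝ,
            IsCWPurePotential w p' → IsNonStrategic q' → IsCWPureHarmonic w h' →
            c = p' + q' + h' → p' = p ∧ q' = q ∧ h' = h) := by
  have hk0 (i : Fin n) : k i ≠ 0 := by have := hk i; omega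
  have hPN (p q : Fin n → (∀ j, Fin (k j)) → ℝ) (hp : IsCWPurePotential w p)
      (hq : IsNonStrategic q) : gameInner p q = 0 :=
    hp.gameInner_isNonStrategic hk0 hwI hq
  have hPH (p h : Fin n → (∀ j, Fin (k j)) → ℝ) (hp : IsCWPurePotential w p)
      (hh : IsCWPureHarmonic w h) : gameInner p h = 0 :=
    (gameInner_comm p h).trans (hh p (hp.isCWPG hwI))
  have hNH (q h : Fin n → (∀ j, Fin (k j)) → ℝ) (hq : IsNonStrategic q)
      (hh : IsCWPureHarmonic w h) : gameInner q h = 0 :=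
    (gameInner_comm q h).trans (hh q hq.isCWPG)
  refine ⟨hPN, hPH, hNH, fun c => ?_⟩
  obtain ⟨v, h, hv, hh, rfl⟩ := exists_isCWPG_add_isCWPureHarmonic w c
  obtain ⟨p, q, hp, hq, rfl⟩ := hv.exists_isCWPurePotential_add hwI
  refine ⟨p, q, h, hp, hq, hh, rfl, fun p' q' h' hp' hq' hh' heq => ?_⟩
  have hsum : (p' - p) + (q' - q) + (h' - h) = 0 := by
    linear_combination -heq
  have hp0 : p' - p = 0 := eq_zero_of_add_add_eq_zero
    (hPN _ _ (hp'.sub hp) (hq'.sub hq)) (hPH _ _ (hp'.sub hp) (hh'.sub hh)) hsum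
  have hq0 : q' - q = 0 := eq_zero_of_add_add_eq_zero
    ((gameInner_comm _ _).trans (hPN _ _ (hp'.sub hp) (hq'.sub hq)))
    (hNH _ _ (hq'.sub hq) (hh'.sub hh)) (by rwa [add_comm (q' - q)])
  rw [hp0, hq0, zero_add, zero_add] at hsum
  exact ⟨sub_eq_zero.1 hp0, sub_eq_zero.1 hq0, sub_eq_zero.1 hsum⟩
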